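/- arXiv:2209.03668 — 2 statements merged into one kernel-verified Lean document; each statement's English description precedes it below -/
import Mathlib

section
/- Let G ∈ ℝ^{p×d}, h ∈ ℝ^p, fix an index i ∈ {1,…,p}, and let G_i denote the i-th row of G. Suppose U ⊆ ℝ^d is open, λ : U → ℝ is differentiable at a point x̂ ∈ U, λ(x)·(G_iᵀx) = h_i holds for all x ∈ U, and G_iᵀx̂ ≠ 0. Then the corrected-solution map x ↦ λ(x)·x is differentiable at x̂ and its Jacobian (derivative as a linear map ℝ^d → ℝ^d) equals −(λ(x̂)/(G_iᵀx̂))·(x̂ G_iᵀ) + λ(x̂)·I, where x̂ G_iᵀ is the d×d outer-product matrix and I is the d×d identity matrix. -/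
open Matrix

/-- If `g x * φ x` is constant near `a`, with `φ` linear and nonzero at `a`, then the derivative of
`g` at `a` is `-(g a / φ a) • φ`. -/
theorem HasFDerivAt.apply_eq_of_mul_clm_eventually_const {E : Type*} [NormedAddCommGroup E]
    [NormedSpace ℝ E] {g : E → ℝ} {g' φ : E →L[ℝ] ℝ} {a : E} {c : ℝ} (hg : HasFDerivAt g g' a)
    (hconst : ∀ᶠ x in nhds a, g x * φ x = c) (ha : φ a ≠ 0) (v : E) :
    g' v = -(g a / φ a) * φ v := by
  have hzero := (hg.mul φ.hasFDerivAt).unique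
    ((hasFDerivAt_const c a).congr_of_eventuallyEq hconst)
  have hv := congrArg (fun L : E →L[ℝ] ℝ => L v) hzero
  simp only [_root_.add_apply, _root_.smul_apply, _root_.zero_apply, smul_eq_mul] at hv
  field_simp
  linarith

/-- The corrected-solution map `x ↦ λ(x)·x` of the packing correction is differentiable
at `x̂` and its Jacobian equals `−(λ(x̂)/(Gᵢᵀx̂))·(x̂ Gᵢᵀ) + λ(x̂)·I`, where `x̂ Gᵢᵀ` is the
outer-product matrix and `I` the identity. -/
theorem stmt_1 {p d : ℕ} (G : Fin p → Fin d → ℝ) (h : Fin p → ℝ) (i : Fin p)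
    (U : Set (Fin d → ℝ)) (hU : IsOpen U)
    (lam : (Fin d → ℝ) → ℝ) (xhat : Fin d → ℝ) (hxU : xhat ∈ U)
    (hdiff : DifferentiableAt ℝ lam xhat)
    (htight : ∀ x ∈ U, lam x * (G i ⬝ᵥ x) = h i)
    (hne : G i ⬝ᵥ xhat ≠ 0) :
    DifferentiableAt ℝ (fun x => lam x • x) xhat ∧
    ∀ v : Fin d → ℝ,
      fderiv ℝ (fun x => lam x • x) xhat v =
        ((-(lam xhat / (G i ⬝ᵥ xhat))) • Matrix.vecMulVec xhat (G i)
          + lam xhat • (1 : Matrix (Fin d) (Fin d) ℝ)).mulVec v := by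
  let φ : (Fin d → ℝ) →L[ℝ] ℝ := (dotProductBilin ℝ ℝ (G i)).toContinuousLinearMap
  have hmap := hdiff.hasFDerivAt.smul (hasFDerivAt_id xhat)
  refine ⟨hmap.differentiableAt, fun v => ?_⟩
  have hconst : ∀ᶠ x in nhds xhat, lam x * φ x = h i :=
    Filter.eventually_of_mem (hU.mem_nhds hxU) htight
  have hlam : fderiv ℝ lam xhat v = -(lam xhat / (G i ⬝ᵥ xhat)) * (G i ⬝ᵥ v) :=
    hdiff.hasFDerivAt.apply_eq_of_mul_clm_eventually_const hconst hne v
  have hmv : fderiv ℝ (fun x => lam x • x) xhat v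
      = lam xhat • v + fderiv ℝ lam xhat v • xhat :=
    congrArg (fun L : (Fin d → ℝ) →L[ℝ] (Fin d → ℝ) => L v) hmap.fderiv
  rw [hmv, hlam, add_mulVec, smul_mulVec, smul_mulVec, one_mulVec, vecMulVec_mulVec]
  ext j
  simp only [Pi.add_apply, Pi.smul_apply, smul_eq_mul, MulOpposite.smul_eq_mul_unop,
    MulOpposite.unop_op]
  ring
end

section
/- Let G ∈ ℝ^{p×d}, h ∈ ℝ^p, fix an index i ∈ {1,…,p}, and let G_i denote the i-th row of G. Suppose U ⊆ ℝ^d is open, λ : U → ℝ is differentiable at x̂ ∈ U, λ(x)·(G_iᵀx) = h_i holds for all x ∈ U (the i-th covering constraint is tight after scaling up), and G_iᵀx̂ ≠ 0. Then the corrected-solution map x ↦ λ(x)·x of the covering correction is differentiable at x̂, the gradient of λ at x̂ equals ∇λ(x̂) = −(λ(x̂)/(G_iᵀx̂))·G_i, and the Jacobian of x ↦ λ(x)·x at x̂ equals −(λ(x̂)/(G_iᵀx̂))·(x̂ G_iᵀ) + λ(x̂)·I. -/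
open Matrix

/-- For the covering correction function `x ↦ λ(x)·x` with tightness `λ(x)·(Gᵢᵀx) = hᵢ` on
an open set: the map is differentiable at `x̂`, `∇λ(x̂) = −(λ(x̂)/(Gᵢᵀx̂))·Gᵢ`, and the
Jacobian of `x ↦ λ(x)·x` at `x̂` is `−(λ(x̂)/(Gᵢᵀx̂))·(x̂ Gᵢᵀ) + λ(x̂)·I`. -/
theorem stmt_8 {p d : ℕ} (G : Fin p → Fin d → ℝ) (h : Fin p → ℝ) (i : Fin p)
    (U : Set (Fin d → ℝ)) (hU : IsOpen U)
    (lam : (Fin d → ℝ) → ℝ) (xhat : Fin d → ℝ) (hxU : xhat ∈ U)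
    (hdiff : DifferentiableAt ℝ lam xhat)
    (htight : ∀ x ∈ U, lam x * (G i ⬝ᵥ x) = h i)
    (hne : G i ⬝ᵥ xhat ≠ 0) :
    DifferentiableAt ℝ (fun x => lam x • x) xhat ∧
    (∀ v : Fin d → ℝ,
      fderiv ℝ lam xhat v = -(lam xhat / (G i ⬝ᵥ xhat)) * (G i ⬝ᵥ v)) ∧
    (∀ v : Fin d → ℝ,
      fderiv ℝ (fun x => lam x • x) xhat v =
        ((-(lam xhat / (G i ⬝ᵥ xhat))) • Matrix.vecMulVec xhat (G i)
          + lam xhat • (1 : Matrix (Fin d) (Fin d) ℝ)).mulVec v) := by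
  have hgrad : ∀ v : Fin d → ℝ,
      fderiv ℝ lam xhat v = -(lam xhat / (G i ⬝ᵥ xhat)) * (G i ⬝ᵥ v) := by
    intro v
    have hdot : HasFDerivAt (fun x : Fin d → ℝ => G i ⬝ᵥ x)
        (LinearMap.toContinuousLinearMap (dotProductBilin ℝ ℝ (G i))) xhat :=
      (LinearMap.toContinuousLinearMap (dotProductBilin ℝ ℝ (G i))).hasFDerivAt
    have hconst : (fun x => lam x * (G i ⬝ᵥ x)) =ᶠ[nhds xhat] fun _ => h i :=
      Filter.eventually_of_mem (hU.mem_nhds hxU) htight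
    have hzero := (hdiff.hasFDerivAt.mul hdot).unique
      ((hasFDerivAt_const (h i) xhat).congr_of_eventuallyEq hconst)
    have hv : lam xhat * (G i ⬝ᵥ v) + (G i ⬝ᵥ xhat) * fderiv ℝ lam xhat v = 0 := by
      simpa using DFunLike.congr_fun hzero v
    field_simp
    linarith
  have hsmul := hdiff.hasFDerivAt.smul (hasFDerivAt_id xhat)
  refine ⟨hsmul.differentiableAt, hgrad, fun v => ?_⟩
  have hfd : fderiv ℝ (fun x => lam x • x) xhat v =
      lam xhat • v + fderiv ℝ lam xhat v • xhat := by
    exact (DFunLike.congr_fun hsmul.fderiv v).trans (by simp)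
  rw [hfd, hgrad, Matrix.add_mulVec, Matrix.smul_mulVec, Matrix.smul_mulVec,
    Matrix.one_mulVec, Matrix.vecMulVec_mulVec]
  ext j
  simp
  ring
end
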